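/- arXiv:1012.0618 — 5 statements merged into one kernel-verified Lean document; each statement's English description precedes it below -/
import Mathlib

section
/- Let I_1, …, I_r be ideals in R = ℂ[∂_1,…,∂_n] and let ω ∈ ℝ^n be a weight vector. Then the intersection of the radicals of the initial ideals equals the radical of the initial ideal of the intersection: ⋂_{j=1}^r √(in_ω(I_j)) = √(in_ω(⋂_{j=1}^r I_j)). -/
open MvPolynomial

noncomputable section

/-- The `ω`-weight of an exponent vector `u`, namely `ω · u`. -/
def wt {n : ℕ} (ω : Fin n → ℝ) (u : Fin n →₀ ℕ) : ℝ := ∑ i, ω i * (u i : ℝ)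

open scoped Classical in
/-- The initial form `in_ω(f)`: the sum of the terms of `f` whose `ω`-weight is maximal
among the exponents appearing in `f`.  (For `f = 0` this is `0`.) -/
def initialForm {n : ℕ} (ω : Fin n → ℝ) (f : MvPolynomial (Fin n) ℂ) :
    MvPolynomial (Fin n) ℂ :=
  ∑ u ∈ f.support.filter (fun u => ∀ v ∈ f.support, wt ω v ≤ wt ω u),
    monomial u (f.coeff u)

/-- The initial ideal `in_ω(I)`, generated by the initial forms of the nonzero elements
of `I`. -/
def initialIdeal {n : ℕ} (ω : Fin n → ℝ) (I : Ideal (MvPolynomial (Fin n) ℂ)) :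
    Ideal (MvPolynomial (Fin n) ℂ) :=
  Ideal.span { g | ∃ f ∈ I, f ≠ 0 ∧ g = initialForm ω f }

theorem wt_add' {n : ℕ} (ω : Fin n → ℝ) (u v : Fin n →₀ ℕ) :
    wt ω (u + v) = wt ω u + wt ω v := by
  simp [wt, mul_add, Finset.sum_add_distrib]

theorem coeff_initialForm {n : ℕ} (ω : Fin n → ℝ) (f : MvPolynomial (Fin n) ℂ) (a : ℝ)
    (ha : ∀ v ∈ f.support, wt ω v ≤ a) (hb : ∃ v ∈ f.support, wt ω v = a) (u : Fin n →₀ ℕ) :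
    (initialForm ω f).coeff u = if wt ω u = a then f.coeff u else 0 := by
  classical
  unfold initialForm
  simp only [coeff_sum, coeff_monomial, Finset.sum_ite_eq', Finset.mem_filter]
  obtain ⟨w, hw, rfl⟩ := hb
  by_cases hu : u ∈ f.support
  · have : (∀ v ∈ f.support, wt ω v ≤ wt ω u) ↔ wt ω u = wt ω w :=
      ⟨fun h => le_antisymm (ha u hu) (h w hw), fun h v hv => h ▸ ha v hv⟩
    simp only [hu, this, true_and]
  · have h0 : f.coeff u = 0 := by simpa using hu
    simp [h0]

theorem exists_top {n : ℕ} (ω : Fin n → ℝ) (f : MvPolynomial (Fin n) ℂ) (hf : f ≠ 0) :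
    ∃ w ∈ f.support, ∀ v ∈ f.support, wt ω v ≤ wt ω w :=
  Finset.exists_max_image f.support (wt ω) (by simpa using hf)

theorem initialForm_of_add {n : ℕ} (ω : Fin n → ℝ) (P Q : MvPolynomial (Fin n) ℂ) (c : ℝ)
    (hP : P ≠ 0) (h1 : ∀ v ∈ P.support, wt ω v = c) (h2 : ∀ v ∈ Q.support, wt ω v < c) :
    initialForm ω (P + Q) = P := by
  classical
  have hQ : ∀ v, wt ω v = c → Q.coeff v = 0 := fun v hv => by
    by_contra h
    exact (h2 v (mem_support_iff.2 h)).ne hv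
  ext u
  rw [coeff_initialForm ω (P + Q) c]
  · split_ifs with h
    · simp [hQ u h]
    · by_contra h'
      exact h (h1 u (mem_support_iff.2 (Ne.symm h')))
  · intro v hv
    rcases Finset.mem_union.1 (support_add hv) with h | h
    · exact (h1 v h).le
    · exact (h2 v h).le
  · obtain ⟨w, hw⟩ := (support_nonempty.2 hP)
    refine ⟨w, ?_, h1 w hw⟩
    rw [mem_support_iff, coeff_add, hQ w (h1 w hw), add_zero]
    exact mem_support_iff.1 hw

theorem exists_decomp {n : ℕ} (ω : Fin n → ℝ) (f : MvPolynomial (Fin n) ℂ) (hf : f ≠ 0) :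
    ∃ (a : ℝ) (Q : MvPolynomial (Fin n) ℂ), f = initialForm ω f + Q ∧ initialForm ω f ≠ 0 ∧
      (∀ v ∈ (initialForm ω f).support, wt ω v = a) ∧ (∀ v ∈ Q.support, wt ω v < a) := by
  obtain ⟨w, hw, hm⟩ := exists_top ω f hf
  have hc := coeff_initialForm ω f (wt ω w) hm ⟨w, hw, rfl⟩
  refine ⟨wt ω w, f - initialForm ω f, by ring, ?_, ?_, ?_⟩
  · intro h
    have := hc w
    rw [h] at this
    simp at this
    exact mem_support_iff.1 hw this.symm
  · intro v hv
    rw [mem_support_iff, hc] at hv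
    by_contra h
    simp [h] at hv
  · intro v hv
    rw [mem_support_iff, coeff_sub, hc] at hv
    split_ifs at hv with h
    · simp at hv
    · exact lt_of_le_of_ne (hm v (mem_support_iff.2 (by simpa using hv))) h

theorem initialForm_mul {n : ℕ} (ω : Fin n → ℝ) (f g : MvPolynomial (Fin n) ℂ)
    (hf : f ≠ 0) (hg : g ≠ 0) :
    initialForm ω (f * g) = initialForm ω f * initialForm ω g := by
  classical
  obtain ⟨a, Q, e1, n1, p1, q1⟩ := exists_decomp ω f hf
  obtain ⟨b, S, e2, n2, p2, q2⟩ := exists_decomp ω g hg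
  generalize initialForm ω f = P at *
  generalize initialForm ω g = T at *
  have : f * g = P * T + (P * S + Q * (T + S)) := by rw [e1, e2]; ring
  rw [this]
  refine initialForm_of_add ω _ _ (a + b) (mul_ne_zero n1 n2) ?_ ?_
  · intro v hv
    obtain ⟨x, hx, y, hy, rfl⟩ := Finset.mem_add.1 (support_mul _ _ hv)
    rw [wt_add', p1 x hx, p2 y hy]
  · intro v hv
    rcases Finset.mem_union.1 (support_add hv) with h | h
    · obtain ⟨x, hx, y, hy, rfl⟩ := Finset.mem_add.1 (support_mul _ _ h)
      rw [wt_add', p1 x hx]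
      linarith [q2 y hy]
    · obtain ⟨x, hx, y, hy, rfl⟩ := Finset.mem_add.1 (support_mul _ _ h)
      rw [wt_add']
      rcases Finset.mem_union.1 (support_add hy) with h | h
      · linarith [q1 x hx, p2 y h]
      · linarith [q1 x hx, q2 y h]

theorem initialIdeal_mono {n : ℕ} (ω : Fin n → ℝ) {I J : Ideal (MvPolynomial (Fin n) ℂ)}
    (h : I ≤ J) : initialIdeal ω I ≤ initialIdeal ω J :=
  Ideal.span_mono (fun _ ⟨f, hf, h0, e⟩ => ⟨f, h hf, h0, e⟩)

theorem initialIdeal_mul_le {n : ℕ} (ω : Fin n → ℝ) (I J : Ideal (MvPolynomial (Fin n) ℂ)) :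
    initialIdeal ω I * initialIdeal ω J ≤ initialIdeal ω (I ⊓ J) := by
  unfold initialIdeal
  rw [Ideal.span_mul_span', Ideal.span_le]
  rintro _ ⟨_, ⟨f, hf, f0, rfl⟩, _, ⟨g, hg, g0, rfl⟩, rfl⟩
  exact Ideal.subset_span ⟨f * g, ⟨I.mul_mem_right _ hf, J.mul_mem_left _ hg⟩,
    mul_ne_zero f0 g0, (initialForm_mul ω f g f0 g0).symm⟩

theorem initialIdeal_top {n : ℕ} (ω : Fin n → ℝ) :
    initialIdeal ω (⊤ : Ideal (MvPolynomial (Fin n) ℂ)) = ⊤ := by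
  classical
  rw [Ideal.eq_top_iff_one]
  refine Ideal.subset_span ⟨1, trivial, one_ne_zero, ?_⟩
  have := initialForm_of_add ω 1 0 0 one_ne_zero ?_ (by simp)
  · simpa using this.symm
  · intro v hv
    rw [mem_support_iff, coeff_one] at hv
    have : v = 0 := by
      by_contra h
      simp [Ne.symm h] at hv
    simp [this, wt]

/-- Lemma (radical of initial ideal of an intersection):
`⋂_j √(in_ω(I_j)) = √(in_ω(⋂_j I_j))`. -/
theorem inf_radical_initialIdeal_eq_radical_initialIdeal_inf
    {n : ℕ} (r : ℕ) (I : Fin r → Ideal (MvPolynomial (Fin n) ℂ)) (ω : Fin n → ℝ) :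
    (⨅ j, (initialIdeal ω (I j)).radical) = (initialIdeal ω (⨅ j, I j)).radical := by
  classical
  apply le_antisymm
  · have key : ∀ s : Finset (Fin r), s.inf (fun j => (initialIdeal ω (I j)).radical) ≤
        (initialIdeal ω (s.inf I)).radical := by
      intro s
      induction s using Finset.induction_on with
      | empty => simp [initialIdeal_top, Ideal.radical_top]
      | insert a s ha ih =>
        rw [Finset.inf_insert, Finset.inf_insert]
        refine (inf_le_inf_left _ ih).trans ?_
        rw [← Ideal.radical_inf, Ideal.radical_inf, ← Ideal.radical_mul]
        exact Ideal.radical_mono (initialIdeal_mul_le ω _ _)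
    simpa [Finset.inf_univ_eq_iInf] using key Finset.univ
  · exact le_iInf fun j => Ideal.radical_mono (initialIdeal_mono ω (iInf_le I j))
end
end

section
/- Let J ⊆ {1,…,n}, let Λ ⊆ ℤ^J be a sublattice (viewed inside ℤ^n by extension by zero) satisfying Λ ∩ ℕ^J = {0}, and let ρ : Λ → ℂ* be a partial character. Then for every j ∈ J and every integer m ≥ 1 the monomial ∂_j^m does not belong to the ideal I_ρ + m_J of R = ℂ[∂_1,…,∂_n]. In particular, if C is a primary ideal of R with radical I_ρ + m_J, then for every j ∈ J the variable ∂_j is a nonzerodivisor on R/C. -/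
open MvPolynomial

noncomputable section

/-- The positive part `u₊ ∈ ℕ^n` of an integer vector `u ∈ ℤ^n`. -/
def posPart {n : ℕ} (u : Fin n → ℤ) : Fin n →₀ ℕ :=
  Finsupp.ofSupportFinite (fun i => (u i).toNat) (Set.toFinite _)

/-- The negative part `u₋ ∈ ℕ^n` of an integer vector `u ∈ ℤ^n` (so `u = u₊ - u₋`). -/
def negPart {n : ℕ} (u : Fin n → ℤ) : Fin n →₀ ℕ :=
  Finsupp.ofSupportFinite (fun i => (-(u i)).toNat) (Set.toFinite _)

/-- The lattice ideal `I_ρ` attached to a partial character `ρ` on a sublattice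
`Λ ⊆ ℤ^n`: it is generated by the binomials `∂^{u₊} - ρ(u) ∂^{u₋}` for `u ∈ Λ`. -/
def latticeIdeal {n : ℕ} (Λ : AddSubgroup (Fin n → ℤ)) (ρ : Λ → ℂˣ) :
    Ideal (MvPolynomial (Fin n) ℂ) :=
  Ideal.span { g | ∃ u : Λ, g = monomial (posPart (u : Fin n → ℤ)) 1 -
      MvPolynomial.C (ρ u : ℂ) * monomial (negPart (u : Fin n → ℤ)) 1 }

/-- The monomial ideal `m_J`, generated by the variables `∂_j` for `j ∉ J`. -/
def mJ {n : ℕ} (J : Set (Fin n)) : Ideal (MvPolynomial (Fin n) ℂ) :=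
  Ideal.span { g | ∃ i ∉ J, g = X i }

theorem exists_char_ext {n : ℕ} (Λ : AddSubgroup (Fin n → ℤ))
    (ρ : Λ → ℂˣ) (hρ : ∀ u v : Λ, ρ (u + v) = ρ u * ρ v) :
    ∃ c : Fin n → ℂˣ, ∀ u : Λ, ρ u = ∏ i, c i ^ ((u : Fin n → ℤ) i) := by
  have hs : ∀ {m : ℕ}, m ≠ 0 → Function.Surjective (fun a : Additive ℂˣ => m • a) := by
    intro m hm a
    obtain ⟨z, hz⟩ := IsAlgClosed.exists_pow_nat_eq ((Additive.toMul a : ℂˣ) : ℂ)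
      (Nat.pos_of_ne_zero hm)
    have hz0 : z ≠ 0 := by
      rintro rfl
      rw [zero_pow hm] at hz
      exact (Additive.toMul a).ne_zero hz.symm
    refine ⟨Additive.ofMul (Units.mk0 z hz0), ?_⟩
    apply Additive.toMul.injective
    apply Units.ext
    simpa using hz
  let _ : DivisibleBy (Additive ℂˣ) ℕ := divisibleByOfSMulRightSurj _ _ hs
  let _ : DivisibleBy (Additive ℂˣ) ℤ := AddGroup.divisibleByIntOfDivisibleByNat _
  let g : Λ →+ Additive ℂˣ := AddMonoidHom.mk' (fun u => Additive.ofMul (ρ u)) (by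
    intro u v
    rw [hρ, ofMul_mul])
  obtain ⟨h, hh⟩ := (Module.Baer.of_divisible (Additive ℂˣ)).extension_property_addMonoidHom
    Λ.subtype Λ.subtype_injective g
  refine ⟨fun i => Additive.toMul (h (Pi.single i 1)), fun u => ?_⟩
  have h1 : h (u : Fin n → ℤ) = Additive.ofMul (ρ u) := DFunLike.congr_fun hh u
  have h2 : (u : Fin n → ℤ) = ∑ i, (u : Fin n → ℤ) i • (Pi.single i 1 : Fin n → ℤ) := by
    ext k
    simp [Finset.sum_apply, Pi.single_apply]
  rw [h2, map_sum] at h1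
  have h3 := congrArg Additive.toMul h1
  rw [toMul_sum] at h3
  simp only [map_zsmul, toMul_zsmul, toMul_ofMul] at h3
  exact h3.symm

theorem exists_point {n : ℕ} (J : Set (Fin n)) (Λ : AddSubgroup (Fin n → ℤ))
    (hsupp : ∀ u ∈ Λ, ∀ i, i ∉ J → u i = 0)
    (ρ : Λ → ℂˣ) (hρ : ∀ u v : Λ, ρ (u + v) = ρ u * ρ v) :
    ∃ x : Fin n → ℂ, (∀ j ∈ J, x j ≠ 0) ∧
      latticeIdeal Λ ρ ⊔ mJ J ≤ RingHom.ker (MvPolynomial.eval x) := by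
  classical
  obtain ⟨c, hc⟩ := exists_char_ext Λ ρ hρ
  refine ⟨fun i => if i ∈ J then (c i : ℂ) else 0, fun j hj => by simp [hj], ?_⟩
  refine sup_le (Ideal.span_le.2 ?_) (Ideal.span_le.2 ?_)
  · rintro _ ⟨u, rfl⟩
    have e1 : ∀ (w : Fin n →₀ ℕ), (∀ i, i ∉ J → w i = 0) →
        MvPolynomial.eval (fun i => if i ∈ J then (c i : ℂ) else 0) (monomial w 1)
          = ((∏ i, c i ^ w i : ℂˣ) : ℂ) := by
      intro w hw
      rw [eval_monomial, one_mul, Finsupp.prod_fintype _ _ (by simp), Units.coe_prod]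
      refine Finset.prod_congr rfl fun i _ => ?_
      by_cases hi : i ∈ J
      · simp [hi]
      · simp [hw i hi]
    have hp : ∀ i, i ∉ J → (posPart (u : Fin n → ℤ) : Fin n →₀ ℕ) i = 0 := fun i hi => by
      change ((u : Fin n → ℤ) i).toNat = 0
      rw [hsupp u u.2 i hi]; rfl
    have hn : ∀ i, i ∉ J → (negPart (u : Fin n → ℤ) : Fin n →₀ ℕ) i = 0 := fun i hi => by
      change (-(u : Fin n → ℤ) i).toNat = 0
      rw [hsupp u u.2 i hi]; rfl
    rw [SetLike.mem_coe, RingHom.mem_ker, map_sub, map_mul, eval_C, e1 _ hp, e1 _ hn, hc u,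
      ← Units.val_mul, ← Finset.prod_mul_distrib, sub_eq_zero]
    congr 1
    refine Finset.prod_congr rfl fun i _ => ?_
    change c i ^ ((u : Fin n → ℤ) i).toNat = c i ^ _ * c i ^ (-(u : Fin n → ℤ) i).toNat
    rw [← zpow_natCast, ← zpow_natCast, ← zpow_add]
    congr 1
    omega
  · rintro _ ⟨i, hi, rfl⟩
    simp [RingHom.mem_ker, hi]

/-- For a sublattice `Λ ⊆ ℤ^J` with `Λ ∩ ℕ^J = {0}` and a partial character `ρ` on `Λ`,
no power `∂_j^m` (`j ∈ J`, `m ≥ 1`) lies in `I_ρ + m_J`; in particular, for any primary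
ideal `C` with radical `I_ρ + m_J`, each `∂_j` with `j ∈ J` is a nonzerodivisor on `R/C`. -/
theorem pow_X_not_mem_latticeIdeal_sup_mJ
    {n : ℕ} (J : Set (Fin n)) (Λ : AddSubgroup (Fin n → ℤ))
    (hsupp : ∀ u ∈ Λ, ∀ i, i ∉ J → u i = 0)
    (hpos : ∀ u ∈ Λ, (∀ i, 0 ≤ u i) → u = 0)
    (ρ : Λ → ℂˣ) (hρ : ∀ u v : Λ, ρ (u + v) = ρ u * ρ v) :
    (∀ j ∈ J, ∀ m : ℕ, 1 ≤ m →
        (X j : MvPolynomial (Fin n) ℂ) ^ m ∉ latticeIdeal Λ ρ ⊔ mJ J) ∧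
    (∀ Q : Ideal (MvPolynomial (Fin n) ℂ), Q.IsPrimary →
        Q.radical = latticeIdeal Λ ρ ⊔ mJ J →
        ∀ j ∈ J, ∀ f : MvPolynomial (Fin n) ℂ, X j * f ∈ Q → f ∈ Q) := by
  have key : ∀ j ∈ J, ∀ m : ℕ,
      (X j : MvPolynomial (Fin n) ℂ) ^ m ∉ latticeIdeal Λ ρ ⊔ mJ J := by
    obtain ⟨x, hx, hle⟩ := exists_point J Λ hsupp ρ hρ
    intro j hj m hm
    have := hle hm
    rw [RingHom.mem_ker, map_pow, eval_X] at this
    exact pow_ne_zero m (hx j hj) this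
  refine ⟨fun j hj m _ => key j hj m, fun Q hQ hrad j hj f hf => ?_⟩
  rw [mul_comm] at hf
  refine ((Ideal.isPrimary_iff.mp hQ).2 hf).resolve_right fun h => ?_
  rw [hrad] at h
  exact key j hj 1 (by simpa using h)
end
end

section
/- Let J ⊆ {1,…,n}, let Λ ⊆ ℤ^J be a sublattice, ρ : Λ → ℂ* a partial character, r ≥ 1 an integer, and let C ⊆ R = ℂ[∂_1,…,∂_n] be a binomial ideal with I_ρ + m_J^r ⊆ C ⊆ I_ρ + m_J. Then there exists a binomial ideal B ⊆ R with m_J^r ⊆ B ⊆ m_J such that C = I_ρ + B. -/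
open MvPolynomial

noncomputable section

/-- An ideal is binomial if it is generated by polynomials with at most two
monomial terms. -/
def IsBinomialIdeal {n : ℕ} (I : Ideal (MvPolynomial (Fin n) ℂ)) : Prop :=
  ∃ S : Set (MvPolynomial (Fin n) ℂ),
    (∀ f ∈ S, f.support.card ≤ 2) ∧ I = Ideal.span S

open scoped Pointwise

/-- Setting the variables outside `J` to zero. -/
def projJ {n : ℕ} (J : Set (Fin n)) : MvPolynomial (Fin n) ℂ →ₐ[ℂ] MvPolynomial (Fin n) ℂ :=
  open Classical in aeval (fun i => if i ∈ J then X i else 0)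

theorem projJ_monomial_mem {n : ℕ} (J : Set (Fin n)) (m : Fin n →₀ ℕ) (c : ℂ)
    (h : ∀ i, i ∉ J → m i = 0) : projJ J (monomial m c) = monomial m c := by
  classical
  rw [projJ, aeval_monomial, monomial_eq]
  congr 1
  refine Finset.prod_congr rfl fun i hi => ?_
  have : i ∈ J := by
    by_contra h'
    exact (Finsupp.mem_support_iff.mp hi) (h i h')
  simp [this]

theorem projJ_monomial_notMem {n : ℕ} (J : Set (Fin n)) (m : Fin n →₀ ℕ) (c : ℂ)
    (h : ¬ ∀ i, i ∉ J → m i = 0) : projJ J (monomial m c) = 0 := by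
  classical
  push Not at h
  obtain ⟨i, hi, hm⟩ := h
  rw [projJ, aeval_monomial]
  have : (m.prod fun i k => (if i ∈ J then (X i : MvPolynomial (Fin n) ℂ) else 0) ^ k) = 0 :=
    Finset.prod_eq_zero (Finsupp.mem_support_iff.mpr hm) (by simp [hi, hm])
  rw [this, mul_zero]

theorem sub_projJ_support {n : ℕ} (J : Set (Fin n)) (f : MvPolynomial (Fin n) ℂ) :
    (f - projJ J f).support ⊆ f.support := by
  classical
  have : f - projJ J f = ∑ m ∈ f.support,
      (monomial m (coeff m f) - projJ J (monomial m (coeff m f))) := by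
    rw [Finset.sum_sub_distrib, ← map_sum, ← f.as_sum]
  rw [this]
  intro x hx
  obtain ⟨m, hm, hx⟩ := Finset.mem_biUnion.mp (support_sum hx)
  by_cases h : ∀ i, i ∉ J → m i = 0
  · rw [projJ_monomial_mem J m _ h] at hx
    simp at hx
  · rw [projJ_monomial_notMem J m _ h, sub_zero] at hx
    have := support_monomial_subset hx
    rw [Finset.mem_singleton] at this
    exact this ▸ hm

theorem sub_projJ_mem {n : ℕ} (J : Set (Fin n)) (f : MvPolynomial (Fin n) ℂ) :
    f - projJ J f ∈ mJ J := by
  classical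
  induction f using MvPolynomial.induction_on with
  | C a => simp [projJ]
  | add p q hp hq =>
    have := Ideal.add_mem _ hp hq
    rw [map_add]
    convert this using 1
    ring
  | mul_X p i hp =>
    have hX : X i - projJ J (X i) ∈ mJ J := by
      by_cases h : i ∈ J
      · simp [projJ, h]
      · have : X i ∈ mJ J := Ideal.subset_span ⟨i, h, rfl⟩
        simpa [projJ, h] using this
    have := Ideal.add_mem _ (Ideal.mul_mem_right (X i) _ hp)
      (Ideal.mul_mem_left _ (projJ J p) hX)
    rw [map_mul]
    convert this using 1
    ring

theorem projJ_mem {n : ℕ} (J : Set (Fin n)) (Λ : AddSubgroup (Fin n → ℤ))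
    (hsupp : ∀ u ∈ Λ, ∀ i, i ∉ J → u i = 0) (ρ : Λ → ℂˣ)
    (f : MvPolynomial (Fin n) ℂ) (hf : f ∈ latticeIdeal Λ ρ ⊔ mJ J) :
    projJ J f ∈ latticeIdeal Λ ρ := by
  classical
  have : latticeIdeal Λ ρ ⊔ mJ J ≤ (latticeIdeal Λ ρ).comap (projJ J) := by
    refine sup_le (Ideal.span_le.mpr ?_) (Ideal.span_le.mpr ?_)
    · rintro g ⟨u, rfl⟩
      change projJ J _ ∈ latticeIdeal Λ ρ
      have hu := hsupp u u.2
      have hp : projJ J (monomial (posPart (u : Fin n → ℤ)) 1)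
          = monomial (posPart (u : Fin n → ℤ)) 1 :=
        projJ_monomial_mem J _ _ fun i hi => by
          change ((u : Fin n → ℤ) i).toNat = 0
          simp [hu i hi]
      have hq : projJ J (monomial (negPart (u : Fin n → ℤ)) 1)
          = monomial (negPart (u : Fin n → ℤ)) 1 :=
        projJ_monomial_mem J _ _ fun i hi => by
          change (-(u : Fin n → ℤ) i).toNat = 0
          simp [hu i hi]
      have hc : projJ J (MvPolynomial.C (ρ u : ℂ)) = MvPolynomial.C (ρ u : ℂ) :=
        (projJ J).commutes _
      rw [map_sub, map_mul, hp, hq, hc]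
      exact Ideal.subset_span ⟨u, rfl⟩
    · rintro g ⟨i, hi, rfl⟩
      change projJ J _ ∈ latticeIdeal Λ ρ
      simp [projJ, hi]
  exact this hf

theorem mJ_pow_gen {n : ℕ} (J : Set (Fin n)) (r : ℕ) :
    ∀ g ∈ { g : MvPolynomial (Fin n) ℂ | ∃ i ∉ J, g = X i } ^ r,
      ∃ m : Fin n →₀ ℕ, g = monomial m 1 := by
  induction r with
  | zero =>
    intro g hg
    rw [pow_zero, Set.mem_one] at hg
    exact ⟨0, hg⟩
  | succ k ih =>
    intro g hg
    rw [pow_succ] at hg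
    obtain ⟨a, ha, b, ⟨i, _, rfl⟩, rfl⟩ := Set.mem_mul.mp hg
    obtain ⟨m, rfl⟩ := ih a ha
    exact ⟨m + Finsupp.single i 1, by rw [X, monomial_mul, one_mul]⟩

/-- If `C` is a binomial ideal with `I_ρ + m_J^r ⊆ C ⊆ I_ρ + m_J`, then `C = I_ρ + B`
for some binomial ideal `B` with `m_J^r ⊆ B ⊆ m_J`. -/
theorem exists_binomial_ideal_decomposition
    {n : ℕ} (J : Set (Fin n)) (Λ : AddSubgroup (Fin n → ℤ))
    (hsupp : ∀ u ∈ Λ, ∀ i, i ∉ J → u i = 0)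
    (ρ : Λ → ℂˣ) (hρ : ∀ u v : Λ, ρ (u + v) = ρ u * ρ v)
    (r : ℕ) (hr : 1 ≤ r)
    (Cid : Ideal (MvPolynomial (Fin n) ℂ)) (hCbin : IsBinomialIdeal Cid)
    (h1 : latticeIdeal Λ ρ ⊔ (mJ J) ^ r ≤ Cid)
    (h2 : Cid ≤ latticeIdeal Λ ρ ⊔ mJ J) :
    ∃ B : Ideal (MvPolynomial (Fin n) ℂ), IsBinomialIdeal B ∧
      (mJ J) ^ r ≤ B ∧ B ≤ mJ J ∧ Cid = latticeIdeal Λ ρ ⊔ B := by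
  obtain ⟨S, hS, rfl⟩ := hCbin
  refine ⟨Ideal.span {f | f.support.card ≤ 2 ∧ f ∈ Ideal.span S ∧ f ∈ mJ J},
    ⟨_, fun f hf => hf.1, rfl⟩, ?_, Ideal.span_le.mpr fun f hf => hf.2.2, le_antisymm ?_ ?_⟩
  · have hle : mJ J ^ r ≤ Ideal.span S := le_sup_right.trans h1
    have hle' : mJ J ^ r ≤ mJ J := Ideal.pow_le_self (by omega)
    have key : mJ J ^ r = Ideal.span ({ g | ∃ i ∉ J, g = X i } ^ r) :=
      Submodule.span_pow _ _
    conv_lhs => rw [key]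
    refine Ideal.span_le.mpr fun g hg => Ideal.subset_span ?_
    have hg' : g ∈ mJ J ^ r := key ▸ Ideal.subset_span hg
    refine ⟨?_, hle hg', hle' hg'⟩
    obtain ⟨m, rfl⟩ := mJ_pow_gen J r g hg
    exact (Finset.card_le_card support_monomial_subset).trans (by simp)
  · refine Ideal.span_le.mpr fun f hf => ?_
    have hfC : f ∈ Ideal.span S := Ideal.subset_span hf
    have hp := projJ_mem J Λ hsupp ρ f (h2 hfC)
    have hpC : projJ J f ∈ Ideal.span S := h1 (Ideal.mem_sup_left hp)
    have hd : f - projJ J f ∈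
        Ideal.span {f | f.support.card ≤ 2 ∧ f ∈ Ideal.span S ∧ f ∈ mJ J} :=
      Ideal.subset_span ⟨(Finset.card_le_card (sub_projJ_support J f)).trans (hS f hf),
        Ideal.sub_mem _ hfC hpC, sub_projJ_mem J f⟩
    have := Ideal.add_mem _ (Ideal.mem_sup_left hp) (Ideal.mem_sup_right hd)
    rwa [add_sub_cancel] at this
  · exact sup_le (le_sup_left.trans h1) (Ideal.span_le.mpr fun f hf => hf.2.1)
end
end

section
/- In the polynomial ring ℂ[∂_1,∂_2,∂_3,∂_4], the ideal I = ⟨∂_1²∂_2 − ∂_2², ∂_2∂_3, ∂_2∂_4, ∂_1²∂_3 − ∂_3²∂_4, ∂_1²∂_4 − ∂_3∂_4²⟩ equals the intersection I_1 ∩ I_2 ∩ I_3, where I_1 = ⟨∂_2, ∂_3, ∂_4⟩, I_2 = ⟨∂_1² − ∂_2, ∂_3, ∂_4⟩ and I_3 = ⟨∂_2, ∂_1² − ∂_3∂_4⟩; moreover each of the ideals I_1, I_2, I_3 is prime. -/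
open MvPolynomial

noncomputable section

abbrev R4 : Type := MvPolynomial (Fin 4) ℂ

def d1 : R4 := X 0
def d2 : R4 := X 1
def d3 : R4 := X 2
def d4 : R4 := X 3

theorem prime_of_retract {S : Type} [CommRing S] [IsDomain S] [Algebra ℂ S] (I : Ideal R4)
    (φ : R4 →ₐ[ℂ] S) (ι : S →ₐ[ℂ] R4) (hI : ∀ f ∈ I, φ f = 0)
    (h : ∀ i, X i - ι (φ (X i)) ∈ I) : I.IsPrime := by
  have key : ∀ f, f - ι (φ f) ∈ I := by
    intro f
    have : (Ideal.Quotient.mkₐ ℂ I) = (Ideal.Quotient.mkₐ ℂ I).comp (ι.comp φ) := by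
      apply MvPolynomial.algHom_ext
      intro i
      exact (Ideal.Quotient.mk_eq_mk_iff_sub_mem _ _).2 (h i)
    exact (Ideal.Quotient.mk_eq_mk_iff_sub_mem _ _).1 (DFunLike.congr_fun this f)
  have : I = RingHom.ker φ := by
    ext f
    constructor
    · exact fun hf => hI f hf
    · intro hf
      have h1 := key f
      rw [RingHom.mem_ker] at hf
      simpa [hf] using h1
  rw [this]
  exact RingHom.ker_isPrime _

theorem mem_span3 {a b c f : R4} : f ∈ Ideal.span ({a, b, c} : Set R4) ↔
    ∃ x y z, f = x * a + y * b + z * c := by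
  rw [Ideal.mem_span_insert]
  constructor
  · rintro ⟨x, w, hw, rfl⟩
    obtain ⟨y, z, rfl⟩ := Ideal.mem_span_pair.1 hw
    exact ⟨x, y, z, by ring⟩
  · rintro ⟨x, y, z, rfl⟩
    exact ⟨x, y * b + z * c, Ideal.mem_span_pair.2 ⟨y, z, rfl⟩, by ring⟩

def phi1 : R4 →ₐ[ℂ] Polynomial ℂ := aeval ![Polynomial.X, 0, 0, 0]
def phi2 : R4 →ₐ[ℂ] Polynomial ℂ := aeval ![Polynomial.X, Polynomial.X ^ 2, 0, 0]
def phi3 : R4 →ₐ[ℂ] MvPolynomial (Fin 2) ℂ := aeval ![X 0 * X 1, 0, X 0 ^ 2, X 1 ^ 2]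
def io : MvPolynomial (Fin 2) ℂ →ₐ[ℂ] R4 := aeval ![X 2, X 3]
def sg : MvPolynomial (Fin 2) ℂ →ₐ[ℂ] MvPolynomial (Fin 2) ℂ := aeval ![-X 0, X 1]

theorem phi1_zero : ∀ f ∈ Ideal.span ({d2, d3, d4} : Set R4), phi1 f = 0 := by
  intro f hf
  obtain ⟨x, y, z, rfl⟩ := mem_span3.1 hf
  simp [phi1, d2, d3, d4]

theorem phi2_zero : ∀ f ∈ Ideal.span ({d1 ^ 2 - d2, d3, d4} : Set R4), phi2 f = 0 := by
  intro f hf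
  obtain ⟨x, y, z, rfl⟩ := mem_span3.1 hf
  simp [phi2, d1, d2, d3, d4]

theorem prime1 : (Ideal.span ({d2, d3, d4} : Set R4)).IsPrime := by
  apply prime_of_retract _ phi1 (Polynomial.aeval d1) phi1_zero
  intro i
  rw [mem_span3]
  fin_cases i
  · exact ⟨0, 0, 0, by simp [phi1, d1]⟩
  · exact ⟨1, 0, 0, by simp [phi1, d2]⟩
  · exact ⟨0, 1, 0, by simp [phi1, d3]⟩
  · exact ⟨0, 0, 1, by simp [phi1, d4]⟩

theorem prime2 : (Ideal.span ({d1 ^ 2 - d2, d3, d4} : Set R4)).IsPrime := by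
  apply prime_of_retract _ phi2 (Polynomial.aeval d1) phi2_zero
  intro i
  rw [mem_span3]
  fin_cases i
  · exact ⟨0, 0, 0, by simp [phi2, d1]⟩
  · exact ⟨-1, 0, 0, by simp [phi2, d1, d2]⟩
  · exact ⟨0, 1, 0, by simp [phi2, d3]⟩
  · exact ⟨0, 0, 1, by simp [phi2, d4]⟩

theorem normal3 (f : R4) : ∃ A B : MvPolynomial (Fin 2) ℂ, ∃ x y : R4,
    f = io A + d1 * io B + (x * d2 + y * (d1 ^ 2 - d3 * d4)) := by
  induction f using MvPolynomial.induction_on with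
  | C a => exact ⟨C a, 0, 0, 0, by simp [io, MvPolynomial.algebraMap_eq]⟩
  | add p q hp hq =>
    obtain ⟨A, B, x, y, rfl⟩ := hp
    obtain ⟨A', B', x', y', rfl⟩ := hq
    exact ⟨A + A', B + B', x + x', y + y', by simp only [map_add]; ring⟩
  | mul_X p i hp =>
    obtain ⟨A, B, x, y, rfl⟩ := hp
    have e0 : io (X 0) = d3 := by simp [io, d3]
    have e1 : io (X 1) = d4 := by simp [io, d4]
    fin_cases i
    · refine ⟨X 0 * X 1 * B, A, x * d1, y * d1 + io B, ?_⟩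
      change _ * d1 = _
      simp only [map_mul, e0, e1]; ring
    · refine ⟨0, 0, io A + d1 * io B + (x * d2 + y * (d1 ^ 2 - d3 * d4)), 0, ?_⟩
      change _ * d2 = _
      simp only [map_zero]; ring
    · refine ⟨A * X 0, B * X 0, x * d3, y * d3, ?_⟩
      change _ * d3 = _
      simp only [map_mul, e0]; ring
    · refine ⟨A * X 1, B * X 1, x * d4, y * d4, ?_⟩
      change _ * d4 = _
      simp only [map_mul, e1]; ring

theorem phi3_io (A : MvPolynomial (Fin 2) ℂ) : phi3 (io A) = expand 2 A := by
  have : phi3.comp io = expand 2 := by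
    apply MvPolynomial.algHom_ext
    intro i
    fin_cases i <;> simp [phi3, io]
  exact DFunLike.congr_fun this A

theorem sg_expand (A : MvPolynomial (Fin 2) ℂ) : sg (expand 2 A) = expand 2 A := by
  have : sg.comp (expand 2) = expand 2 := by
    apply MvPolynomial.algHom_ext
    intro i
    fin_cases i <;> simp [sg]
  exact DFunLike.congr_fun this A

theorem expand2_zero {A : MvPolynomial (Fin 2) ℂ} (h : expand 2 A = 0) : A = 0 := by
  exact expand_injective two_pos (by rw [h, map_zero])

theorem prime3 : (Ideal.span ({d2, d1 ^ 2 - d3 * d4} : Set R4)).IsPrime := by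
  have : Ideal.span ({d2, d1 ^ 2 - d3 * d4} : Set R4) = RingHom.ker phi3 := by
    have hz : ∀ x y : R4, phi3 (x * d2 + y * (d1 ^ 2 - d3 * d4)) = 0 := by
      intro x y
      have : (X 0 * X 1 : MvPolynomial (Fin 2) ℂ) ^ 2 - X 0 ^ 2 * X 1 ^ 2 = 0 := by ring
      simp [phi3, d1, d2, d3, d4, this]
    ext f
    rw [RingHom.mem_ker, Ideal.mem_span_pair]
    constructor
    · rintro ⟨x, y, rfl⟩
      exact hz x y
    · intro hf
      obtain ⟨A, B, x, y, rfl⟩ := normal3 f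
      have e : phi3 d1 = X 0 * X 1 := by simp [phi3, d1]
      rw [map_add, hz, add_zero, map_add, map_mul, phi3_io, phi3_io, e] at hf
      have h2 := congrArg sg hf
      have e0 : sg (X 0) = - X 0 := by simp [sg]
      have e1 : sg (X 1) = X 1 := by simp [sg]
      simp only [map_add, map_mul, sg_expand, e0, e1, map_zero] at h2
      have hA : expand 2 A = 0 := by
        have : (2 : MvPolynomial (Fin 2) ℂ) * expand 2 A = 0 := by linear_combination hf + h2
        exact (mul_eq_zero.1 this).resolve_left two_ne_zero
      have hB : expand 2 B = 0 := by
        rw [hA, zero_add] at hf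
        exact (mul_eq_zero.1 hf).resolve_left (mul_ne_zero (X_ne_zero _) (X_ne_zero _))
      rw [expand2_zero hA, expand2_zero hB]
      exact ⟨x, y, by simp⟩
  rw [this]
  exact RingHom.ker_isPrime _

/-- The ideal `I = ⟨∂₁²∂₂ − ∂₂², ∂₂∂₃, ∂₂∂₄, ∂₁²∂₃ − ∂₃²∂₄, ∂₁²∂₄ − ∂₃∂₄²⟩`
equals the intersection of the three prime ideals `I₁ = ⟨∂₂, ∂₃, ∂₄⟩`,
`I₂ = ⟨∂₁² − ∂₂, ∂₃, ∂₄⟩` and `I₃ = ⟨∂₂, ∂₁² − ∂₃∂₄⟩`. -/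
theorem example_prime_decomposition :
    Ideal.span ({d1 ^ 2 * d2 - d2 ^ 2, d2 * d3, d2 * d4,
        d1 ^ 2 * d3 - d3 ^ 2 * d4, d1 ^ 2 * d4 - d3 * d4 ^ 2} : Set R4) =
      Ideal.span ({d2, d3, d4} : Set R4) ⊓
      Ideal.span ({d1 ^ 2 - d2, d3, d4} : Set R4) ⊓
      Ideal.span ({d2, d1 ^ 2 - d3 * d4} : Set R4) ∧
    (Ideal.span ({d2, d3, d4} : Set R4)).IsPrime ∧
    (Ideal.span ({d1 ^ 2 - d2, d3, d4} : Set R4)).IsPrime ∧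
    (Ideal.span ({d2, d1 ^ 2 - d3 * d4} : Set R4)).IsPrime := by
  refine ⟨?_, prime1, prime2, prime3⟩
  have hd1 : d1 ∉ Ideal.span ({d2, d3, d4} : Set R4) := by
    intro h
    have := phi1_zero _ h
    simp [phi1, d1] at this
  have hd2 : d2 ∉ Ideal.span ({d1 ^ 2 - d2, d3, d4} : Set R4) := by
    intro h
    have := phi2_zero _ h
    simp [phi2, d2] at this
  set I := Ideal.span ({d1 ^ 2 * d2 - d2 ^ 2, d2 * d3, d2 * d4,
        d1 ^ 2 * d3 - d3 ^ 2 * d4, d1 ^ 2 * d4 - d3 * d4 ^ 2} : Set R4) with hI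
  have g1 : d1 ^ 2 * d2 - d2 ^ 2 ∈ I := Ideal.subset_span (by simp)
  have g2 : d2 * d3 ∈ I := Ideal.subset_span (by simp)
  have g3 : d2 * d4 ∈ I := Ideal.subset_span (by simp)
  have g4 : d1 ^ 2 * d3 - d3 ^ 2 * d4 ∈ I := Ideal.subset_span (by simp)
  have g5 : d1 ^ 2 * d4 - d3 * d4 ^ 2 ∈ I := Ideal.subset_span (by simp)
  apply le_antisymm
  · rw [hI, Ideal.span_le]
    intro f hf
    simp only [Set.mem_insert_iff, Set.mem_singleton_iff] at hf
    refine ⟨⟨mem_span3.2 ?_, mem_span3.2 ?_⟩, Ideal.mem_span_pair.2 ?_⟩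
    · rcases hf with rfl | rfl | rfl | rfl | rfl
      · exact ⟨d1 ^ 2 - d2, 0, 0, by ring⟩
      · exact ⟨d3, 0, 0, by ring⟩
      · exact ⟨d4, 0, 0, by ring⟩
      · exact ⟨0, d1 ^ 2 - d3 * d4, 0, by ring⟩
      · exact ⟨0, 0, d1 ^ 2 - d3 * d4, by ring⟩
    · rcases hf with rfl | rfl | rfl | rfl | rfl
      · exact ⟨d2, 0, 0, by ring⟩
      · exact ⟨0, d2, 0, by ring⟩
      · exact ⟨0, 0, d2, by ring⟩
      · exact ⟨0, d1 ^ 2 - d3 * d4, 0, by ring⟩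
      · exact ⟨0, 0, d1 ^ 2 - d3 * d4, by ring⟩
    · rcases hf with rfl | rfl | rfl | rfl | rfl
      · exact ⟨d1 ^ 2 - d2, 0, by ring⟩
      · exact ⟨d3, 0, by ring⟩
      · exact ⟨d4, 0, by ring⟩
      · exact ⟨0, d3, by ring⟩
      · exact ⟨0, d4, by ring⟩
  · rintro f ⟨⟨h1, h2⟩, h3⟩
    obtain ⟨u, v, rfl⟩ := Ideal.mem_span_pair.1 h3
    have hv : v ∈ Ideal.span ({d2, d3, d4} : Set R4) := by
      obtain ⟨x, y, z, e⟩ := mem_span3.1 h1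
      have : v * d1 ^ 2 ∈ Ideal.span ({d2, d3, d4} : Set R4) :=
        mem_span3.2 ⟨x - u, y + v * d4, z, by linear_combination e⟩
      rcases prime1.mem_or_mem this with h | h
      · exact h
      · exact absurd (prime1.mem_of_pow_mem _ h) hd1
    obtain ⟨v2, v3, v4, rfl⟩ := mem_span3.1 hv
    have hw : u + v2 * (d1 ^ 2 - d3 * d4) ∈ Ideal.span ({d1 ^ 2 - d2, d3, d4} : Set R4) := by
      obtain ⟨x, y, z, e⟩ := mem_span3.1 h2
      have : (u + v2 * (d1 ^ 2 - d3 * d4)) * d2 ∈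
          Ideal.span ({d1 ^ 2 - d2, d3, d4} : Set R4) :=
        mem_span3.2 ⟨x, y - v3 * (d1 ^ 2 - d3 * d4), z - v4 * (d1 ^ 2 - d3 * d4),
          by linear_combination e⟩
      exact (prime2.mem_or_mem this).resolve_right hd2
    obtain ⟨p, q, r, e⟩ := mem_span3.1 hw
    have : u * d2 + (v2 * d2 + v3 * d3 + v4 * d4) * (d1 ^ 2 - d3 * d4) =
        p * (d1 ^ 2 * d2 - d2 ^ 2) + q * (d2 * d3) + r * (d2 * d4)
        + v3 * (d1 ^ 2 * d3 - d3 ^ 2 * d4) + v4 * (d1 ^ 2 * d4 - d3 * d4 ^ 2) := by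
      linear_combination d2 * e
    rw [this]
    exact I.add_mem (I.add_mem (I.add_mem (I.add_mem (I.mul_mem_left _ g1)
      (I.mul_mem_left _ g2)) (I.mul_mem_left _ g3)) (I.mul_mem_left _ g4)) (I.mul_mem_left _ g5)
end
end

section
/- In the polynomial ring ℂ[∂_x,∂_y,∂_z,∂_t], the binomial ideal C = ⟨∂_x³ − ∂_y², ∂_z² − ∂_x∂_t, ∂_t²⟩ is a primary ideal and its radical is √C = ⟨∂_x³ − ∂_y², ∂_z, ∂_t⟩; moreover √C is a prime ideal. -/
open MvPolynomial

noncomputable section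

def dx : R4 := X 0
def dy : R4 := X 1
def dz : R4 := X 2
def dt : R4 := X 3

/-- The binomial ideal `C = ⟨∂ₓ³ − ∂ᵧ², ∂_z² − ∂ₓ∂_t, ∂_t²⟩`. -/
def Cex : Ideal R4 :=
  Ideal.span ({dx ^ 3 - dy ^ 2, dz ^ 2 - dx * dt, dt ^ 2} : Set R4)

lemma parity_aux (p q : Polynomial ℂ)
    (h : Polynomial.expand ℂ 2 p + Polynomial.X ^ 3 * Polynomial.expand ℂ 2 q = 0) : p = 0 ∧ q = 0 := by
  constructor
  · ext n
    have := congrArg (fun f => Polynomial.coeff f (n * 2)) h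
    simp only [Polynomial.coeff_add, Polynomial.coeff_expand_mul (by norm_num : 0 < 2), Polynomial.coeff_X_pow_mul',
      Polynomial.coeff_expand (by norm_num : 0 < 2), Polynomial.coeff_zero] at this
    split_ifs at this with h1 h2
    · omega
    · simpa using this
    · simpa using this
  · ext n
    have := congrArg (fun f => Polynomial.coeff f (n * 2 + 3)) h
    simp only [Polynomial.coeff_add, Polynomial.coeff_X_pow_mul, Polynomial.coeff_expand_mul (by norm_num : 0 < 2),
      Polynomial.coeff_expand (by norm_num : 0 < 2) p, Polynomial.coeff_zero] at this
    rw [if_neg (by omega)] at this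
    simpa using this

def phi : R4 →ₐ[ℂ] Polynomial (Polynomial ℂ) :=
  aeval ![Polynomial.C (Polynomial.X ^ 2), Polynomial.C (Polynomial.X ^ 3),
    Polynomial.C Polynomial.X * Polynomial.X, Polynomial.X ^ 2]

lemma phi_x : phi dx = Polynomial.C (Polynomial.X ^ 2) := by simp [phi, dx]
lemma phi_y : phi dy = Polynomial.C (Polynomial.X ^ 3) := by simp [phi, dy]
lemma phi_z : phi dz = Polynomial.C Polynomial.X * Polynomial.X := by simp [phi, dz]
lemma phi_t : phi dt = Polynomial.X ^ 2 := by simp [phi, dt]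

def bl (p q : Polynomial ℂ) : R4 := Polynomial.aeval dx p + dy * Polynomial.aeval dx q

lemma phi_bl (p q : Polynomial ℂ) : phi (bl p q) =
    Polynomial.C (Polynomial.expand ℂ 2 p + Polynomial.X ^ 3 * Polynomial.expand ℂ 2 q) := by
  have key : ∀ r : Polynomial ℂ, phi (Polynomial.aeval dx r) =
      Polynomial.C (Polynomial.expand ℂ 2 r) := by
    intro r
    rw [← Polynomial.aeval_algHom_apply, phi_x]
    induction r using Polynomial.induction_on' with
    | add a b ha hb => rw [map_add, map_add, map_add, ha, hb]
    | monomial n a =>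
      rw [Polynomial.aeval_monomial, Polynomial.expand_monomial,
        ← Polynomial.C_mul_X_pow_eq_monomial, Polynomial.C_mul, ← Polynomial.C_pow, ← pow_mul,
        mul_comm 2 n]
      rfl
  simp only [bl, map_add, map_mul, key, phi_y]

def nf (p q : Fin 4 → Polynomial ℂ) : R4 :=
  bl (p 0) (q 0) + dz * bl (p 1) (q 1) + dt * bl (p 2) (q 2) + dz * dt * bl (p 3) (q 3)

lemma nf_exists (f : R4) : ∃ p q, f - nf p q ∈ Cex := by
  have h1 : dx ^ 3 - dy ^ 2 ∈ Cex := Ideal.subset_span (by simp)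
  have h2 : dz ^ 2 - dx * dt ∈ Cex := Ideal.subset_span (by simp)
  have h3 : dt ^ 2 ∈ Cex := Ideal.subset_span (by simp)
  simp only [← Ideal.Quotient.eq_zero_iff_mem, map_sub, map_mul, map_pow] at h1 h2 h3 ⊢
  induction f using MvPolynomial.induction_on with
  | C a =>
    refine ⟨![Polynomial.C a, 0, 0, 0], 0, ?_⟩
    simp [nf, bl, MvPolynomial.algebraMap_eq]
  | add f g hf hg =>
    obtain ⟨p, q, h⟩ := hf
    obtain ⟨p', q', h'⟩ := hg
    refine ⟨p + p', q + q', ?_⟩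
    simp only [nf, bl, map_add, map_mul, Pi.add_apply] at h h' ⊢
    linear_combination h + h'
  | mul_X f i hf =>
    obtain ⟨p, q, h⟩ := hf
    fin_cases i
    · refine ⟨fun i => Polynomial.X * p i, fun i => Polynomial.X * q i, ?_⟩
      change Ideal.Quotient.mk Cex (f * dx) - _ = 0
      simp only [nf, bl, map_add, map_mul, Polynomial.aeval_X] at h ⊢
      linear_combination Ideal.Quotient.mk Cex dx * h
    · refine ⟨fun i => Polynomial.X ^ 3 * q i, fun i => p i, ?_⟩
      change Ideal.Quotient.mk Cex (f * dy) - _ = 0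
      simp only [nf, bl, map_add, map_mul, map_pow, Polynomial.aeval_X] at h ⊢
      generalize Ideal.Quotient.mk Cex dx = x at *
      generalize Ideal.Quotient.mk Cex dy = y at *
      generalize Ideal.Quotient.mk Cex dz = z at *
      generalize Ideal.Quotient.mk Cex dt = t at *
      linear_combination y * h - h1 *
        (Ideal.Quotient.mk Cex (Polynomial.aeval dx (q 0))
        + z * Ideal.Quotient.mk Cex (Polynomial.aeval dx (q 1))
        + t * Ideal.Quotient.mk Cex (Polynomial.aeval dx (q 2))
        + z * t * Ideal.Quotient.mk Cex (Polynomial.aeval dx (q 3)))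
    · refine ⟨![0, p 0, Polynomial.X * p 1, p 2], ![0, q 0, Polynomial.X * q 1, q 2], ?_⟩
      change Ideal.Quotient.mk Cex (f * dz) - _ = 0
      simp [nf, bl] at h ⊢
      generalize Ideal.Quotient.mk Cex dx = x at *
      generalize Ideal.Quotient.mk Cex dy = y at *
      generalize Ideal.Quotient.mk Cex dz = z at *
      generalize Ideal.Quotient.mk Cex dt = t at *
      generalize Ideal.Quotient.mk Cex (Polynomial.aeval dx (p 1)) = p1 at *
      generalize Ideal.Quotient.mk Cex (Polynomial.aeval dx (q 1)) = q1 at *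
      generalize Ideal.Quotient.mk Cex (Polynomial.aeval dx (p 3)) = p3 at *
      generalize Ideal.Quotient.mk Cex (Polynomial.aeval dx (q 3)) = q3 at *
      linear_combination z * h + h2 * ((p1 + y * q1) + t * (p3 + y * q3))
        + h3 * x * (p3 + y * q3)
    · refine ⟨![0, 0, p 0, p 1], ![0, 0, q 0, q 1], ?_⟩
      change Ideal.Quotient.mk Cex (f * dt) - _ = 0
      simp [nf, bl] at h ⊢
      generalize Ideal.Quotient.mk Cex dx = x at *
      generalize Ideal.Quotient.mk Cex dy = y at *
      generalize Ideal.Quotient.mk Cex dz = z at *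
      generalize Ideal.Quotient.mk Cex dt = t at *
      generalize Ideal.Quotient.mk Cex (Polynomial.aeval dx (p 2)) = p2 at *
      generalize Ideal.Quotient.mk Cex (Polynomial.aeval dx (q 2)) = q2 at *
      generalize Ideal.Quotient.mk Cex (Polynomial.aeval dx (p 3)) = p3 at *
      generalize Ideal.Quotient.mk Cex (Polynomial.aeval dx (q 3)) = q3 at *
      linear_combination t * h + h3 * ((p2 + y * q2) + z * (p3 + y * q3))

lemma phi_nf (p q : Fin 4 → Polynomial ℂ) : ∃ a : Fin 4 → Polynomial ℂ,
    (∀ i, a i = 0 → p i = 0 ∧ q i = 0) ∧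
    phi (nf p q) = Polynomial.C (a 0) + Polynomial.C (Polynomial.X * a 1) * Polynomial.X ^ 1
      + Polynomial.C (a 2) * Polynomial.X ^ 2
      + Polynomial.C (Polynomial.X * a 3) * Polynomial.X ^ 3 := by
  refine ⟨fun i => Polynomial.expand ℂ 2 (p i) + Polynomial.X ^ 3 * Polynomial.expand ℂ 2 (q i),
    fun i h => parity_aux _ _ h, ?_⟩
  simp only [nf, map_add, map_mul, phi_bl, phi_z, phi_t]
  ring

def W : Ideal (Polynomial (Polynomial ℂ)) := Ideal.span {Polynomial.X}

lemma W_prime : W.IsPrime := by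
  rw [W, Ideal.span_singleton_prime Polynomial.X_ne_zero]
  exact Polynomial.prime_X

lemma Cex_le : Cex ≤ Ideal.comap phi (Ideal.span {Polynomial.X ^ 4}) := by
  rw [Cex, Ideal.span_le]
  rintro f (rfl | rfl | rfl)
  · have : phi (dx ^ 3 - dy ^ 2) = 0 := by
      simp only [map_sub, map_pow, phi_x, phi_y]; ring
    simp [this]
  · have : phi (dz ^ 2 - dx * dt) = 0 := by
      simp only [map_sub, map_pow, map_mul, phi_x, phi_z, phi_t]; ring
    simp [this]
  · simp only [SetLike.mem_coe, Ideal.mem_comap, map_pow, phi_t, ← pow_mul]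
    exact Ideal.subset_span rfl

lemma Cex_eq : Cex = Ideal.comap phi (Ideal.span {Polynomial.X ^ 4}) := by
  refine le_antisymm Cex_le fun f hf => ?_
  obtain ⟨p, q, h⟩ := nf_exists f
  have h' := Cex_le h
  have h2 := sub_mem hf h'
  rw [sub_sub_cancel, Ideal.mem_comap, Ideal.mem_span_singleton, Polynomial.X_pow_dvd_iff] at h2
  obtain ⟨a, ha, e⟩ := phi_nf p q
  rw [e] at h2
  have z0 : a 0 = 0 := by simpa [Polynomial.coeff_C, Polynomial.coeff_X] using h2 0 (by norm_num)
  have z1 : a 1 = 0 := by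
    simpa [Polynomial.coeff_C, Polynomial.coeff_X, ← Polynomial.C_mul, -map_mul, Polynomial.coeff_C_mul, Polynomial.coeff_X_pow] using h2 1 (by norm_num)
  have z2 : a 2 = 0 := by
    simpa [Polynomial.coeff_C, Polynomial.coeff_X, ← Polynomial.C_mul, -map_mul, Polynomial.coeff_C_mul, Polynomial.coeff_X_pow] using h2 2 (by norm_num)
  have z3 : a 3 = 0 := by
    simpa [Polynomial.coeff_C, Polynomial.coeff_X, ← Polynomial.C_mul, -map_mul, Polynomial.coeff_C_mul, Polynomial.coeff_X_pow] using h2 3 (by norm_num)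
  have : nf p q = 0 := by
    simp [nf, bl, ha 0 z0, ha 1 z1, ha 2 z2, ha 3 z3]
  simpa [this] using h

lemma rad_eq : Ideal.comap phi W = Ideal.span ({dx ^ 3 - dy ^ 2, dz, dt} : Set R4) := by
  have hz : dz ∈ Ideal.span ({dx ^ 3 - dy ^ 2, dz, dt} : Set R4) := Ideal.subset_span (by simp)
  have ht : dt ∈ Ideal.span ({dx ^ 3 - dy ^ 2, dz, dt} : Set R4) := Ideal.subset_span (by simp)
  apply le_antisymm
  · intro f hf
    obtain ⟨p, q, h⟩ := nf_exists f
    have h' : f - nf p q ∈ Ideal.comap phi W := by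
      have := Cex_le h
      rw [Ideal.mem_comap, Ideal.mem_span_singleton] at this
      rw [Ideal.mem_comap, W, Ideal.mem_span_singleton]
      exact (dvd_pow_self _ (by norm_num)).trans this
    have h2 := sub_mem hf h'
    rw [sub_sub_cancel, Ideal.mem_comap, W, Ideal.mem_span_singleton, Polynomial.X_dvd_iff] at h2
    obtain ⟨a, ha, e⟩ := phi_nf p q
    rw [e] at h2
    have z0 : a 0 = 0 := by simpa [Polynomial.coeff_C, Polynomial.coeff_X] using h2
    have hC : Cex ≤ Ideal.span ({dx ^ 3 - dy ^ 2, dz, dt} : Set R4) := by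
      rw [Cex, Ideal.span_le]
      rintro g (rfl | rfl | rfl)
      · exact Ideal.subset_span (by simp)
      · exact sub_mem (Ideal.pow_mem_of_mem _ hz _ (by norm_num)) (Ideal.mul_mem_left _ _ ht)
      · exact Ideal.pow_mem_of_mem _ ht _ (by norm_num)
    have hn : nf p q ∈ Ideal.span ({dx ^ 3 - dy ^ 2, dz, dt} : Set R4) := by
      have : nf p q = bl (p 1) (q 1) * dz + (bl (p 2) (q 2) + dz * bl (p 3) (q 3)) * dt := by
        simp only [nf, ha 0 z0]
        simp only [bl, map_zero]
        ring
      rw [this]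
      exact add_mem (Ideal.mul_mem_left _ _ hz) (Ideal.mul_mem_left _ _ ht)
    simpa using add_mem (hC h) hn
  · rw [Ideal.span_le]
    rintro f (rfl | rfl | rfl)
    · have : phi (dx ^ 3 - dy ^ 2) = 0 := by
        simp only [map_sub, map_pow, phi_x, phi_y]; ring
      simp [this]
    · simp only [SetLike.mem_coe, Ideal.mem_comap, phi_z, W, Ideal.mem_span_singleton]
      exact dvd_mul_left _ _
    · simp only [SetLike.mem_coe, Ideal.mem_comap, phi_t, W, Ideal.mem_span_singleton]
      exact dvd_pow_self _ (by norm_num)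

lemma span_pow_eq : Ideal.span {(Polynomial.X : Polynomial (Polynomial ℂ)) ^ 4} = W ^ 4 := by
  rw [W, Ideal.span_singleton_pow]

lemma Cex_rad : Cex.radical = Ideal.comap phi W := by
  rw [Cex_eq, ← Ideal.comap_radical, span_pow_eq, Ideal.radical_pow _ (by norm_num),
    W_prime.radical]

lemma Cex_mem_iff (f : R4) : f ∈ Cex ↔ (Polynomial.X : Polynomial (Polynomial ℂ)) ^ 4 ∣ phi f := by
  rw [Cex_eq, Ideal.mem_comap, Ideal.mem_span_singleton]

/-- `C` is primary with radical `√C = ⟨∂ₓ³ − ∂ᵧ², ∂_z, ∂_t⟩`, and this radical is a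
prime ideal. -/
theorem example_primary_binomial_ideal :
    Cex.IsPrimary ∧
    Cex.radical = Ideal.span ({dx ^ 3 - dy ^ 2, dz, dt} : Set R4) ∧
    (Ideal.span ({dx ^ 3 - dy ^ 2, dz, dt} : Set R4)).IsPrime := by
  have := W_prime
  have hp : (Ideal.comap phi W).IsPrime := Ideal.comap_isPrime _ _
  refine ⟨?_, Cex_rad.trans rad_eq, rad_eq ▸ hp⟩
  rw [Ideal.isPrimary_iff]
  constructor
  · intro h
    apply hp.ne_top
    rw [← Cex_rad, h, Ideal.radical_top]
  · intro f g hfg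
    by_cases hg : g ∈ Cex.radical
    · exact Or.inr hg
    · left
      rw [Cex_rad, Ideal.mem_comap, W, Ideal.mem_span_singleton] at hg
      rw [Cex_mem_iff, map_mul] at hfg
      rw [Cex_mem_iff]
      exact Polynomial.prime_X.pow_dvd_of_dvd_mul_right 4 hg hfg
end
end
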